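/- Let ρ and σ be the two-qubit states on ℂ² ⊗ ℂ² given by ρ = (1/2)|Ψ⁺⟩⟨Ψ⁺| + (1/3)|Ψ⁻⟩⟨Ψ⁻| + (1/6)|Φ⁺⟩⟨Φ⁺| (i.e., in the ordered basis (|00⟩,|01⟩,|10⟩,|11⟩), ρ has entries ρ₁₁ = ρ₄₄ = 5/12, ρ₁₄ = ρ₄₁ = 1/12, ρ₂₂ = ρ₂₃ = ρ₃₂ = ρ₃₃ = 1/12, all other entries zero) and σ = (2/3)|00⟩⟨00| + (1/3)|11⟩⟨11|. Then for ALL 2×2 unitary matrices U₁, U₂, the commutator [ρ, (U₁⊗U₂)σ(U₁⊗U₂)†] is nonzero; i.e., no local unitary conjugation of σ commutes with ρ. -/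

import Mathlib

open Matrix Kronecker

/-- |Ψ⁺⟩ = (|00⟩ + |11⟩)/√2. -/
noncomputable def psiPlus : Fin 2 × Fin 2 → ℂ := fun p =>
  if p = (0, 0) then ((Real.sqrt 2)⁻¹ : ℝ) else if p = (1, 1) then ((Real.sqrt 2)⁻¹ : ℝ) else 0

/-- |Ψ⁻⟩ = (|00⟩ − |11⟩)/√2. -/
noncomputable def psiMinus : Fin 2 × Fin 2 → ℂ := fun p =>
  if p = (0, 0) then ((Real.sqrt 2)⁻¹ : ℝ) else if p = (1, 1) then (-(Real.sqrt 2)⁻¹ : ℝ) else 0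

/-- |Φ⁺⟩ = (|01⟩ + |10⟩)/√2. -/
noncomputable def phiPlus : Fin 2 × Fin 2 → ℂ := fun p =>
  if p = (0, 1) then ((Real.sqrt 2)⁻¹ : ℝ) else if p = (1, 0) then ((Real.sqrt 2)⁻¹ : ℝ) else 0

/-- The standard basis vector |ab⟩. -/
def ketPair (a b : Fin 2) : Fin 2 × Fin 2 → ℂ := fun p => if p = (a, b) then 1 else 0

/-- ρ = (1/2)|Ψ⁺⟩⟨Ψ⁺| + (1/3)|Ψ⁻⟩⟨Ψ⁻| + (1/6)|Φ⁺⟩⟨Φ⁺|. -/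
noncomputable def rhoEx : Matrix (Fin 2 × Fin 2) (Fin 2 × Fin 2) ℂ :=
  (1 / 2 : ℂ) • Matrix.vecMulVec psiPlus (star psiPlus)
    + (1 / 3 : ℂ) • Matrix.vecMulVec psiMinus (star psiMinus)
    + (1 / 6 : ℂ) • Matrix.vecMulVec phiPlus (star phiPlus)

/-- σ = (2/3)|00⟩⟨00| + (1/3)|11⟩⟨11|. -/
noncomputable def sigmaEx : Matrix (Fin 2 × Fin 2) (Fin 2 × Fin 2) ℂ :=
  (2 / 3 : ℂ) • Matrix.vecMulVec (ketPair 0 0) (star (ketPair 0 0))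
    + (1 / 3 : ℂ) • Matrix.vecMulVec (ketPair 1 1) (star (ketPair 1 1))

/-- The action of ρ on a vector, in coordinates. -/
theorem rhoEx_mulVec (v : Fin 2 × Fin 2 → ℂ) :
    12 * (rhoEx *ᵥ v) (0, 0) = 5 * v (0, 0) + v (1, 1) ∧
    12 * (rhoEx *ᵥ v) (0, 1) = v (0, 1) + v (1, 0) ∧
    12 * (rhoEx *ᵥ v) (1, 0) = v (0, 1) + v (1, 0) ∧
    12 * (rhoEx *ᵥ v) (1, 1) = v (0, 0) + 5 * v (1, 1) := by
  have h : ((Real.sqrt 2 : ℂ))⁻¹ * ((Real.sqrt 2 : ℂ))⁻¹ = 1 / 2 := by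
    rw [← mul_inv, ← Complex.ofReal_mul, Real.mul_self_sqrt zero_le_two]
    norm_num
  refine ⟨?_, ?_, ?_, ?_⟩ <;>
    simp [Matrix.mulVec, dotProduct, Fintype.sum_prod_type, rhoEx, Matrix.vecMulVec_apply,
      psiPlus, psiMinus, phiPlus, h] <;> ring

theorem sigmaEx_eq_diagonal :
    sigmaEx = Matrix.diagonal
      (fun p => if p = (0, 0) then 2 / 3 else if p = (1, 1) then 1 / 3 else 0) := by
  ext ⟨a, b⟩ ⟨c, d⟩
  fin_cases a <;> fin_cases b <;> fin_cases c <;> fin_cases d <;>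
    simp [sigmaEx, Matrix.vecMulVec_apply, ketPair]

/-- No eigenvector of ρ is a product vector. -/
theorem eq_zero_of_rhoEx_mulVec_eq_smul {v : Fin 2 × Fin 2 → ℂ} {c : ℂ}
    (hv : rhoEx *ᵥ v = c • v) (hprod : v (0, 0) * v (1, 1) = v (0, 1) * v (1, 0)) :
    v = 0 := by
  obtain ⟨h₀₀, h₀₁, h₁₀, h₁₁⟩ := rhoEx_mulVec v
  simp only [hv, Pi.smul_apply, smul_eq_mul] at h₀₀ h₀₁ h₁₀ h₁₁
  generalize hx : v (0, 0) = x at *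
  generalize hy : v (0, 1) = y at *
  generalize hz : v (1, 0) = z at *
  generalize hw : v (1, 1) = w at *
  have key : x = 0 ∧ y = 0 ∧ z = 0 ∧ w = 0 := by
    have hadd : (12 * c - 6) * (x + w) = 0 := by linear_combination h₀₀ + h₁₁
    have hsub : (12 * c - 4) * (x - w) = 0 := by linear_combination h₀₀ - h₁₁
    have hadd' : (12 * c - 2) * (y + z) = 0 := by linear_combination h₀₁ + h₁₀
    have hsub' : c * (y - z) = 0 := by linear_combination (h₀₁ - h₁₀) / 12
    grind
  obtain ⟨rfl, rfl, rfl, rfl⟩ := key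
  ext ⟨a, b⟩
  fin_cases a <;> fin_cases b <;> assumption

/-- If `A` commutes with the conjugate of a diagonal matrix by a unitary `M`, then the column of
`M` belonging to a simple diagonal entry is an eigenvector of `A`. -/
theorem mulVec_col_eq_smul_of_commute_conj_diagonal {n : Type*} [Fintype n] [DecidableEq n]
    {A M : Matrix n n ℂ} {d : n → ℂ} (hM : M ∈ Matrix.unitaryGroup n ℂ)
    (h : Commute A (M * Matrix.diagonal d * Mᴴ)) {j : n} (hj : ∀ i, i ≠ j → d i ≠ d j) :
    A *ᵥ M.col j = (Mᴴ * A * M) j j • M.col j := by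
  have hl : Mᴴ * M = 1 := Matrix.mem_unitaryGroup_iff'.mp hM
  have hr : M * Mᴴ = 1 := Matrix.mem_unitaryGroup_iff.mp hM
  have hcomm : Mᴴ * A * M * Matrix.diagonal d = Matrix.diagonal d * (Mᴴ * A * M) :=
    calc Mᴴ * A * M * Matrix.diagonal d
        = Mᴴ * (A * (M * Matrix.diagonal d * Mᴴ)) * M := by
          simp only [Matrix.mul_assoc, hl, Matrix.mul_one]
      _ = Mᴴ * M * Matrix.diagonal d * (Mᴴ * A * M) := by
          rw [h.eq]; simp only [Matrix.mul_assoc]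
      _ = Matrix.diagonal d * (Mᴴ * A * M) := by rw [hl, Matrix.one_mul]
  have hoff : ∀ i, i ≠ j → (Mᴴ * A * M) i j = 0 := fun i hi => by
    have := congrFun (congrFun hcomm i) j
    rw [Matrix.mul_diagonal, Matrix.diagonal_mul] at this
    have hmul : (d i - d j) * (Mᴴ * A * M) i j = 0 := by linear_combination -this
    exact (mul_eq_zero.mp hmul).resolve_left (sub_ne_zero.mpr (hj i hi))
  have hAM : A * M = M * (Mᴴ * A * M) := by
    rw [← Matrix.mul_assoc, ← Matrix.mul_assoc, hr, Matrix.one_mul]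
  ext p
  change (A * M) p j = _
  rw [hAM, Matrix.mul_apply, Finset.sum_eq_single j]
  · simp [mul_comm]
  · intro i _ hi
    rw [hoff i hi, mul_zero]
  · simp

theorem no_local_unitary_makes_commuting :
    ∀ U₁ ∈ Matrix.unitaryGroup (Fin 2) ℂ, ∀ U₂ ∈ Matrix.unitaryGroup (Fin 2) ℂ,
      rhoEx * ((U₁ ⊗ₖ U₂) * sigmaEx * (U₁ ⊗ₖ U₂)ᴴ)
        - ((U₁ ⊗ₖ U₂) * sigmaEx * (U₁ ⊗ₖ U₂)ᴴ) * rhoEx ≠ 0 := by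
  intro U₁ h₁ U₂ h₂ h
  have hM : U₁ ⊗ₖ U₂ ∈ Matrix.unitaryGroup (Fin 2 × Fin 2) ℂ := Matrix.kronecker_mem_unitary h₁ h₂
  rw [sigmaEx_eq_diagonal] at h
  have heig := mulVec_col_eq_smul_of_commute_conj_diagonal hM (sub_eq_zero.mp h) (j := (0, 0))
    (fun i hi => by rw [if_neg hi, if_pos rfl]; split_ifs <;> norm_num)
  have hzero := eq_zero_of_rhoEx_mulVec_eq_smul heig (by simp; ring)
  have hone := congrFun (congrFun (Matrix.mem_unitaryGroup_iff'.mp hM) (0, 0)) (0, 0)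
  rw [Matrix.mul_apply, Finset.sum_eq_zero fun p _ => by
    rw [show (U₁ ⊗ₖ U₂) p (0, 0) = 0 from congrFun hzero p, mul_zero]] at hone
  simp at hone
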